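/- The sequence n² · (5n)!/((n!)⁵ · 5^{5n}) converges as n → ∞, and its limit equals √5/(4π²). -/

import Mathlib

open Filter Real

/-- The normalised quintic coefficient expressed through the Stirling sequence. -/
lemma quintic_coeff_eq_stirlingSeq {n : ℕ} (hn : n ≠ 0) :
    √5 / 4 * (Stirling.stirlingSeq (5 * n) / Stirling.stirlingSeq n ^ 5) =
      (n : ℝ) ^ 2 * ((5 * n).factorial : ℝ) / ((n.factorial : ℝ) ^ 5 * 5 ^ (5 * n)) := by
  have hn' : (0 : ℝ) < n := by positivity
  have hsqrt : √(2 * ((5 * n : ℕ) : ℝ)) = √5 * √(2 * n) := by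
    rw [← sqrt_mul (by norm_num)]
    push_cast
    ring_nf
  have hpow : (((5 * n : ℕ) : ℝ) / exp 1) ^ (5 * n) = 5 ^ (5 * n) * ((n / exp 1) ^ n) ^ 5 := by
    rw [← pow_mul, mul_comm n 5, ← mul_pow]
    push_cast
    ring_nf
  have hfour : √(2 * (n : ℝ)) ^ 4 = 4 * (n : ℝ) ^ 2 := by
    rw [show 4 = 2 * 2 from rfl, pow_mul, sq_sqrt (by positivity)]
    ring
  have hs : √(2 * (n : ℝ)) ≠ 0 := by positivity
  have hp : ((n : ℝ) / exp 1) ^ n ≠ 0 := by positivity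
  have hf : (n.factorial : ℝ) ≠ 0 := by positivity
  rw [Stirling.stirlingSeq, Stirling.stirlingSeq, hsqrt, hpow]
  generalize √(2 * (n : ℝ)) = s at *
  generalize ((n : ℝ) / exp 1) ^ n = p at *
  have h5 : √(5 : ℝ) ≠ 0 := by positivity
  field_simp
  linear_combination hfour

/-- Stirling asymptotics for the quintic hypergeometric coefficients:
`n² (5n)!/((n!)⁵ 5^{5n}) → √5/(4π²)` as `n → ∞`. -/
theorem quintic_coeff_asymptotic :
    Tendsto
      (fun n : ℕ => (n : ℝ) ^ 2 * ((5 * n).factorial : ℝ) /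
        (((n.factorial : ℝ)) ^ 5 * 5 ^ (5 * n)))
      atTop (nhds (Real.sqrt 5 / (4 * π ^ 2))) := by
  have hlim := Stirling.tendsto_stirlingSeq_sqrt_pi
  have hmul : Tendsto (fun n : ℕ => 5 * n) atTop atTop :=
    tendsto_id.const_mul_atTop' (by norm_num)
  have hquot := ((hlim.comp hmul).div (hlim.pow 5) (by positivity)).const_mul (√5 / 4)
  have hvalue : √5 / 4 * (√π / √π ^ 5) = √5 / (4 * π ^ 2) := by
    have hπ : √π ^ 4 = π ^ 2 := by
      rw [show 4 = 2 * 2 from rfl, pow_mul, sq_sqrt pi_pos.le]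
    have : √π ≠ 0 := by positivity
    rw [← hπ]
    field_simp
  rw [hvalue] at hquot
  refine hquot.congr' ?_
  filter_upwards [eventually_ne_atTop 0] with n hn
  exact quintic_coeff_eq_stirlingSeq hn
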